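/- Let n ≥ 1 be an integer and let S be the set of vectors (m_0, m_1, …, m_{n-1}) in (ℤ_{≥0})^n satisfying Σ_{i=0}^{n-1} m_i = n and Σ_{i=0}^{n-1} i·m_i ≡ 0 (mod n). Then the additive sub-semigroup of ℤ^n generated by S equals the set of all vectors (m_0, m_1, …, m_{n-1}) in (ℤ_{≥0})^n satisfying n ∣ Σ_{i=0}^{n-1} m_i and n ∣ Σ_{i=0}^{n-1} i·m_i. -/

import Mathlib

/-- A weighted form of the **Erdős–Ginzburg–Ziv theorem**: a nonnegative integer vector of
total mass at least `2 * n - 1` dominates a nonnegative vector of total mass `n` whose weighted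
sum is divisible by `n`. -/
theorem exists_le_sum_eq_dvd_weighted_sum {ι : Type*} [Fintype ι] (w : ι → ℤ) (n : ℕ)
    (m : ι → ℤ) (hm : ∀ i, 0 ≤ m i) (hsum : 2 * (n : ℤ) - 1 ≤ ∑ i, m i) :
    ∃ v : ι → ℤ, (∀ i, 0 ≤ v i) ∧ (∀ i, v i ≤ m i) ∧ ∑ i, v i = n ∧
      (n : ℤ) ∣ ∑ i, w i * v i := by
  classical
  let s : Finset (Σ _ : ι, ℕ) := Finset.univ.sigma fun i => Finset.range (m i).toNat
  have hs : (s.card : ℤ) = ∑ i, m i := by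
    simp [s, Finset.card_sigma, hm]
  obtain ⟨t, hts, htcard, htdvd⟩ :=
    Int.erdos_ginzburg_ziv (n := n) (s := s) (fun p => w p.1) (by lia)
  refine ⟨fun i => (t.filter fun p => p.1 = i).card, fun i => by positivity, fun i => ?_, ?_, ?_⟩
  · have hle : (t.filter fun p => p.1 = i).card ≤ (Finset.range (m i).toNat).card := by
      refine Finset.card_le_card_of_injOn (fun p => p.2) ?_ ?_
      · intro p hp
        obtain ⟨hpt, rfl⟩ := Finset.mem_filter.mp (Finset.mem_coe.mp hp)
        exact (Finset.mem_sigma.mp (hts hpt)).2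
      · intro p hp q hq hpq
        have hp := (Finset.mem_filter.mp (Finset.mem_coe.mp hp)).2
        have hq := (Finset.mem_filter.mp (Finset.mem_coe.mp hq)).2
        exact Sigma.ext (hp.trans hq.symm) (heq_of_eq hpq)
    have := hm i
    rw [Finset.card_range] at hle
    lia
  · have hfib := Finset.card_eq_sum_card_fiberwise (s := t) (t := Finset.univ)
      (f := fun p : Σ _ : ι, ℕ => p.1) (fun _ _ => Finset.mem_coe.mpr (Finset.mem_univ _))
    beta_reduce
    exact_mod_cast hfib.symm.trans htcard
  · convert htdvd using 1
    rw [← Finset.sum_fiberwise t (fun p => p.1)]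
    refine Finset.sum_congr rfl fun i _ => ?_
    rw [Finset.sum_congr rfl fun p hp => by rw [(Finset.mem_filter.mp hp).2], Finset.sum_const,
      nsmul_eq_mul, mul_comm]

/-- A nonnegative vector with coordinate sum `n * k` and weighted sum divisible by `n` is a sum of
such vectors with coordinate sum `n`. -/
theorem mem_closure_of_sum_eq_mul {ι : Type*} [Fintype ι] (w : ι → ℤ) (n k : ℕ)
    (m : ι → ℤ) (hm : ∀ i, 0 ≤ m i) (hsum : ∑ i, m i = n * k) (hdvd : (n : ℤ) ∣ ∑ i, w i * m i) :
    m ∈ AddSubmonoid.closure {v : ι → ℤ | (∀ i, 0 ≤ v i) ∧ ∑ i, v i = n ∧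
      (n : ℤ) ∣ ∑ i, w i * v i} := by
  induction k generalizing m with
  | zero =>
    have hzero : m = 0 := by
      funext i
      exact (Finset.sum_eq_zero_iff_of_nonneg fun i _ => hm i).mp (by simpa using hsum) i
        (Finset.mem_univ i)
    exact hzero ▸ zero_mem _
  | succ k ih =>
    obtain rfl | hk := k.eq_zero_or_pos
    · exact AddSubmonoid.subset_closure ⟨hm, by simpa using hsum, hdvd⟩
    obtain ⟨v, hv, hvm, hvsum, hvdvd⟩ := exists_le_sum_eq_dvd_weighted_sum w n m hm (by
      rw [hsum]
      push_cast
      have : (1 : ℤ) ≤ k := by exact_mod_cast hk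
      nlinarith [Int.natCast_nonneg n])
    rw [← sub_add_cancel m v]
    refine add_mem (ih (m - v) (fun i => sub_nonneg.mpr (hvm i)) ?_ ?_)
      (AddSubmonoid.subset_closure ⟨hv, hvsum, hvdvd⟩)
    · simp only [Pi.sub_apply, Finset.sum_sub_distrib, hsum, hvsum]
      push_cast
      ring
    · simpa only [Pi.sub_apply, mul_sub, Finset.sum_sub_distrib] using dvd_sub hdvd hvdvd

/-- The additive sub-semigroup of `ℤⁿ` generated by the set `S` of
nonnegative vectors with coordinate sum `n` and weighted sum `≡ 0 (mod n)` equals the set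
of all nonnegative vectors `m` with `n ∣ Σ mᵢ` and `n ∣ Σ i·mᵢ`. -/
theorem semigroup_closure_eq_saturation (n : ℕ) (hn : 1 ≤ n)
    (S : Set (Fin n → ℤ))
    (hS : S = {m : Fin n → ℤ | (∀ i, 0 ≤ m i) ∧ (∑ i, m i) = (n : ℤ) ∧
      (n : ℤ) ∣ ∑ i : Fin n, (i : ℤ) * m i}) :
    (AddSubmonoid.closure S : Set (Fin n → ℤ)) =
      {m : Fin n → ℤ | (∀ i, 0 ≤ m i) ∧ ((n : ℤ) ∣ ∑ i, m i) ∧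
        (n : ℤ) ∣ ∑ i : Fin n, (i : ℤ) * m i} := by
  subst hS
  ext m
  constructor
  · intro h
    induction h using AddSubmonoid.closure_induction with
    | mem x hx => exact ⟨hx.1, hx.2.1 ▸ dvd_rfl, hx.2.2⟩
    | zero => simp
    | add x y _ _ hx hy =>
      refine ⟨fun i => add_nonneg (hx.1 i) (hy.1 i), ?_, ?_⟩
      · simpa only [Pi.add_apply, Finset.sum_add_distrib] using dvd_add hx.2.1 hy.2.1
      · simpa only [Pi.add_apply, mul_add, Finset.sum_add_distrib] using dvd_add hx.2.2 hy.2.2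
  · rintro ⟨hm, ⟨c, hc⟩, hdvd⟩
    have hc0 : 0 ≤ c := by
      have hn' : (0 : ℤ) < n := by exact_mod_cast hn
      exact nonneg_of_mul_nonneg_right (hc ▸ Finset.sum_nonneg fun i _ => hm i) hn'
    lift c to ℕ using hc0
    exact mem_closure_of_sum_eq_mul (fun i : Fin n => (i : ℤ)) n c m hm hc hdvd
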